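/- Let 𝒜 be an abelian category and let E be an object admitting two short exact sequences 0 → A →a E →b B → 0 and 0 → A' →c E →d B' → 0. If the composite d ∘ a : A → B' is a monomorphism, then the composite b ∘ c : A' → B is also a monomorphism, and the cokernel of d ∘ a is isomorphic to the cokernel of b ∘ c. -/

import Mathlib

open CategoryTheory CategoryTheory.Limits

/-- If an object `E` of an abelian category admits two short exact sequences
`0 → A →a E →b B → 0` and `0 → A' →c E →d B' → 0` and the composite
`d ∘ a : A → B'` is a monomorphism, then `b ∘ c : A' → B` is also a monomorphism
and `coker (d ∘ a) ≅ coker (b ∘ c)`. -/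
theorem stmt_6 {𝒜 : Type*} [Category 𝒜] [Abelian 𝒜]
    {A B A' B' E : 𝒜}
    (a : A ⟶ E) (b : E ⟶ B) (wab : a ≫ b = 0)
    (h1 : (ShortComplex.mk a b wab).ShortExact)
    (c : A' ⟶ E) (d : E ⟶ B') (wcd : c ≫ d = 0)
    (h2 : (ShortComplex.mk c d wcd).ShortExact)
    (hmono : Mono (a ≫ d)) :
    Mono (c ≫ b) ∧ Nonempty (cokernel (a ≫ d) ≅ cokernel (c ≫ b)) := by
  have ha : Mono a := h1.mono_f
  have hb : Epi b := h1.epi_g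
  have hc : Mono c := h2.mono_f
  have hd : Epi d := h2.epi_g
  constructor
  · refine Preadditive.mono_of_cancel_zero _ fun {P} f hf => ?_
    obtain ⟨g, hg⟩ : ∃ g : P ⟶ A, g ≫ a = f ≫ c :=
      ⟨h1.exact.lift (f ≫ c) (by simpa using hf), h1.exact.lift_f _ _⟩
    have hg0 : g = 0 := by
      rw [← cancel_mono (a ≫ d), ← Category.assoc, hg, Category.assoc, wcd]
      simp
    rw [← cancel_mono c, ← hg, hg0]
    simp
  · have e1 : c ≫ b ≫ cokernel.π (c ≫ b) = 0 := by
      rw [← Category.assoc, cokernel.condition]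
    have e2 : a ≫ d ≫ cokernel.π (a ≫ d) = 0 := by
      rw [← Category.assoc, cokernel.condition]
    obtain ⟨u, hu⟩ : ∃ u : B' ⟶ cokernel (c ≫ b), d ≫ u = b ≫ cokernel.π (c ≫ b) :=
      ⟨h2.exact.desc _ e1, h2.exact.g_desc _ _⟩
    obtain ⟨v, hv⟩ : ∃ v : B ⟶ cokernel (a ≫ d), b ≫ v = d ≫ cokernel.π (a ≫ d) :=
      ⟨h1.exact.desc _ e2, h1.exact.g_desc _ _⟩
    have hu0 : (a ≫ d) ≫ u = 0 := by
      rw [Category.assoc, hu, ← Category.assoc, wab, zero_comp]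
    have hv0 : (c ≫ b) ≫ v = 0 := by
      rw [Category.assoc, hv, ← Category.assoc, wcd, zero_comp]
    refine ⟨⟨cokernel.desc _ u hu0, cokernel.desc _ v hv0, ?_, ?_⟩⟩
    · rw [← cancel_epi (cokernel.π (a ≫ d)), ← cancel_epi d, cokernel.π_desc_assoc,
        reassoc_of% hu, cokernel.π_desc, hv, Category.comp_id]
    · rw [← cancel_epi (cokernel.π (c ≫ b)), ← cancel_epi b, cokernel.π_desc_assoc,
        reassoc_of% hv, cokernel.π_desc, hu, Category.comp_id]
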